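/- Let V = Fin 2 → ZMod 2. There do not exist a ZMod 2-linear map f : V ⊗[ZMod 2] V →ₗ[ZMod 2] V ⊗[ZMod 2] V and a nonzero vector e : V such that f (v ⊗ₜ e) = v ⊗ₜ v for every nonzero v : V. That is, cloning of arbitrary 1-qubit states is impossible in DQT₂. -/

import Mathlib

open TensorProduct

/-- No-cloning in DQT₂: there is no linear map on `V ⊗ V` (with
`V = Fin 2 → ZMod 2`) together with a nonzero blank state `e` that copies
every nonzero state `v`, i.e. sends `v ⊗ e` to `v ⊗ v`. -/
theorem no_cloning_qubit_mod_two :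
    ¬ ∃ (f : (TensorProduct (ZMod 2) (Fin 2 → ZMod 2) (Fin 2 → ZMod 2)) →ₗ[ZMod 2]
             (TensorProduct (ZMod 2) (Fin 2 → ZMod 2) (Fin 2 → ZMod 2)))
        (e : Fin 2 → ZMod 2), e ≠ 0 ∧
          ∀ v : Fin 2 → ZMod 2, v ≠ 0 → f (v ⊗ₜ[ZMod 2] e) = v ⊗ₜ[ZMod 2] v := by
  rintro ⟨f, e, -, h⟩
  let coord : (Fin 2 → ZMod 2) ⊗[ZMod 2] (Fin 2 → ZMod 2) →ₗ[ZMod 2] ZMod 2 :=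
    LinearMap.mul' (ZMod 2) (ZMod 2) ∘ₗ
      TensorProduct.map (LinearMap.proj 0) (LinearMap.proj 1)
  have hcoord (v : Fin 2 → ZMod 2) (hv : v ≠ 0) : coord (f (v ⊗ₜ[ZMod 2] e)) = v 0 * v 1 := by
    rw [h v hv]
    simp [coord]
  have hsum := hcoord (![1, 0] + ![0, 1]) (by decide)
  rw [TensorProduct.add_tmul, map_add, map_add, hcoord ![1, 0] (by decide),
    hcoord ![0, 1] (by decide)] at hsum
  exact absurd hsum (by decide)
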